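/- arXiv:2501.16690 — 9 statements merged into one kernel-verified Lean document; each statement's English description precedes it below -/
import Mathlib

section
/- Fix δ > 0. Let (X,Y) be a pair of random variables taking values in {1,2,3} × {1,2,3} on a probability space, with P((X,Y) = (i,j)) ≥ δ for all i,j ∈ {1,2,3}. Let u : {1,2,3} → ({1,−1})³ and v : {1,2,3} → ({1,−1})³ be functions such that u⁽¹⁾(x)·u⁽²⁾(x)·u⁽³⁾(x) = 1 for every x and v⁽¹⁾(y)·v⁽²⁾(y)·v⁽³⁾(y) = −1 for every y. Then P(u⁽ʸ⁾(X)·v⁽ˣ⁾(Y) = −1) ≥ δ, where u⁽ʸ⁾(X) denotes the Y-th coordinate of u(X) and v⁽ˣ⁾(Y) denotes the X-th coordinate of v(Y). -/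
open MeasureTheory

/-- A Mermin square cannot be filled consistently: if `u` and `v` are sign triples with coordinate
products `1` and `-1` respectively, then some pair of opposite entries disagrees. -/
theorem exists_mul_eq_neg_one_of_prod_eq (u v : Fin 3 → Fin 3 → ℤ)
    (hu : ∀ x k, u x k = 1 ∨ u x k = -1) (hv : ∀ y k, v y k = 1 ∨ v y k = -1)
    (hup : ∀ x, u x 0 * u x 1 * u x 2 = 1) (hvp : ∀ y, v y 0 * v y 1 * v y 2 = -1) :
    ∃ i j, u i j * v j i = -1 := by
  by_contra! h
  have hone : ∀ i j, u i j * v j i = 1 := fun i j ↦ by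
    have hij := h i j
    rcases hu i j with h₁ | h₁ <;> rcases hv j i with h₂ | h₂ <;> simp_all
  have hprod : ∏ i, ∏ j, u i j * v j i = (∏ i, ∏ j, u i j) * ∏ j, ∏ i, v j i := by
    simp_rw [Finset.prod_mul_distrib]
    rw [Finset.prod_comm (f := fun i j ↦ v j i)]
  have hu_row : ∀ i, ∏ j, u i j = 1 := fun i ↦ by rw [Fin.prod_univ_three, hup]
  have hv_row : ∀ j, ∏ i, v j i = -1 := fun j ↦ by rw [Fin.prod_univ_three, hvp]
  simp_rw [hone, hu_row, hv_row] at hprod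
  norm_num at hprod

/-- If `(X, Y)` is a pair of random variables with values in
`{1,2,3} × {1,2,3}` (modelled as `Fin 3 × Fin 3`) with `P((X,Y) = (i,j)) ≥ δ`
for all `i, j`, and `u, v : Fin 3 → Fin 3 → ℤ` are sign triples (indexed by the
observation) with coordinate products `+1` resp. `-1`, then
`P(u⁽ʸ⁾(X) · v⁽ˣ⁾(Y) = -1) ≥ δ`. -/
theorem stmt_1 {Ω : Type*} [MeasurableSpace Ω] (μ : Measure Ω) [IsProbabilityMeasure μ]
    (δ : ℝ) (hδ : 0 < δ)
    (X Y : Ω → Fin 3) (hX : Measurable X) (hY : Measurable Y)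
    (hXY : ∀ i j : Fin 3, ENNReal.ofReal δ ≤ μ {ω | X ω = i ∧ Y ω = j})
    (u v : Fin 3 → Fin 3 → ℤ)
    (hu : ∀ x k, u x k = 1 ∨ u x k = -1) (hv : ∀ y k, v y k = 1 ∨ v y k = -1)
    (hup : ∀ x, u x 0 * u x 1 * u x 2 = 1)
    (hvp : ∀ y, v y 0 * v y 1 * v y 2 = -1) :
    ENNReal.ofReal δ ≤ μ {ω | u (X ω) (Y ω) * v (Y ω) (X ω) = -1} := by
  obtain ⟨i, j, hij⟩ := exists_mul_eq_neg_one_of_prod_eq u v hu hv hup hvp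
  refine (hXY i j).trans (measure_mono ?_)
  rintro ω ⟨rfl, rfl⟩
  exact hij
end

section
/- Fix 0 < δ < 1/9. Let (Ω, ℱ, P) be a probability space carrying processes (Xₙ)ₙ≥₀, (Yₙ)ₙ≥₀ with values in {1,2,3} and a process (Wₙ)ₙ≥₀ with values in a measurable space 𝒲. For n ≥ 0 let 𝒢ₙ := σ(X₀,…,Xₙ₋₁, Y₀,…,Yₙ₋₁, W₀,…,Wₙ). Assume that for every n ≥ 1 and every i,j ∈ {1,2,3}, P((Xₙ,Yₙ) = (i,j) | 𝒢ₙ) ≥ δ almost surely. Let (Uₙ)ₙ≥₀ and (Vₙ)ₙ≥₀ be processes with values in ({1,−1})³ such that for every n: Uₙ is measurable with respect to σ(X₀,…,Xₙ, W₀,…,Wₙ), Vₙ is measurable with respect to σ(Y₀,…,Yₙ, W₀,…,Wₙ), Uₙ⁽¹⁾·Uₙ⁽²⁾·Uₙ⁽³⁾ = 1 almost surely, and Vₙ⁽¹⁾·Vₙ⁽²⁾·Vₙ⁽³⁾ = −1 almost surely. Then limsup_{N→∞} (1/N) Σ_{n=0}^{N−1} E[Uₙ^{(Yₙ)} · Vₙ^{(Xₙ)}]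 ≤ 1 − 2δ. -/
open MeasureTheory Filter

/-- A sign-valued function measurable with respect to `m ⊔ σ(X)` agrees on each fibre of `X` with
an `m`-measurable sign-valued function. -/
lemma exists_sign_eq_on_fibers {Ω ι : Type*} [MeasurableSpace ι] {m : MeasurableSpace Ω}
    {X : Ω → ι} {f : Ω → ℤ}
    (hf : Measurable[m ⊔ MeasurableSpace.comap X inferInstance] f)
    (hval : ∀ ω, f ω = 1 ∨ f ω = -1) :
    ∃ g : ι → Ω → ℤ, (∀ i, Measurable[m] (g i)) ∧ (∀ i ω, g i ω = 1 ∨ g i ω = -1) ∧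
      ∀ ω, f ω = g (X ω) ω := by
  classical
  have hS : MeasurableSet[m ⊔ MeasurableSpace.comap X inferInstance] (f ⁻¹' {1}) :=
    hf (measurableSet_singleton _)
  have hcomap : m ⊔ MeasurableSpace.comap X inferInstance =
      MeasurableSpace.comap (fun ω => (ω, X ω)) (m.prod inferInstance) := by
    rw [MeasurableSpace.comap_prodMk, ← Function.id_def, MeasurableSpace.comap_id]
  rw [hcomap] at hS
  obtain ⟨S, hSm, hSf⟩ := hS
  have hmem (ω : Ω) : (ω, X ω) ∈ S ↔ f ω = 1 := by
    simpa using Set.ext_iff.1 hSf ω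
  refine ⟨fun i ω => if (ω, i) ∈ S then 1 else -1, fun i => ?_, fun i ω => ?_, fun ω => ?_⟩
  · have hT : MeasurableSet[m] {ω | (ω, i) ∈ S} := measurable_prodMk_right hSm
    exact Measurable.ite hT measurable_const measurable_const
  · by_cases h : (ω, i) ∈ S <;> simp [h]
  · rcases hval ω with h | h
    · simp [(hmem ω).2 h, h]
    · have : (ω, X ω) ∉ S := fun h' => by rw [hmem, h] at h'; norm_num at h'
      simp [this, h]

/-- A sign triple with almost surely constant coordinate product `c`, measurable with respect to
`m ⊔ σ(X)`, agrees almost surely with one selected by `X` from a family of `m`-measurable sign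
triples with coordinate product `c`. -/
lemma exists_sign_triple_eq_on_fibers {Ω ι : Type*} [MeasurableSpace ι] {m mΩ : MeasurableSpace Ω}
    {μ : Measure Ω} {X : Ω → ι} {U : Ω → Fin 3 → ℤ} {c : ℤ}
    (hU : ∀ k, Measurable[m ⊔ MeasurableSpace.comap X inferInstance] (fun ω => U ω k))
    (hval : ∀ ω k, U ω k = 1 ∨ U ω k = -1)
    (hprod : ∀ᵐ ω ∂μ, U ω 0 * U ω 1 * U ω 2 = c) :
    ∃ u : ι → Fin 3 → Ω → ℤ, (∀ i k, Measurable[m] (u i k)) ∧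
      (∀ i ω, u i 0 ω * u i 1 ω * u i 2 ω = c) ∧
      ∀ᵐ ω ∂μ, ∀ k, U ω k = u (X ω) k ω := by
  obtain ⟨g, hgm, hgval, hgU⟩ := exists_sign_eq_on_fibers (hU 0) (hval · 0)
  obtain ⟨h, hhm, hhval, hhU⟩ := exists_sign_eq_on_fibers (hU 1) (hval · 1)
  refine ⟨fun i => ![g i, h i, fun ω => c * (g i ω * h i ω)], fun i k => ?_, fun i ω => ?_, ?_⟩
  · fin_cases k
    · exact hgm i
    · exact hhm i
    · exact ((hgm i).mul (hhm i)).const_mul c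
  · rcases hgval i ω with h1 | h1 <;> rcases hhval i ω with h2 | h2 <;> simp [h1, h2]
  · filter_upwards [hprod] with ω hω k
    fin_cases k
    · exact hgU ω
    · exact hhU ω
    · change U ω 2 = c * (g (X ω) ω * h (X ω) ω)
      rw [← hgU, ← hhU, ← hω]
      rcases hval ω 0 with h1 | h1 <;> rcases hval ω 1 with h2 | h2 <;> simp [h1, h2]

/-- No `3 × 3` array has all row products `1` and all column products `-1`. -/
lemma exists_ne_of_row_prod_of_col_prod {u v : Fin 3 → Fin 3 → ℤ}
    (hu : ∀ i, u i 0 * u i 1 * u i 2 = 1) (hv : ∀ j, v j 0 * v j 1 * v j 2 = -1) :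
    ∃ i j, u i j ≠ v j i := by
  by_contra! h
  have hcol : (∏ j, v j 0 * v j 1 * v j 2) = -1 := by simp [hv]
  have hrow : (∏ i, u i 0 * u i 1 * u i 2) = 1 := by simp [hu]
  simp only [h, Fin.prod_univ_three] at hcol hrow
  linarith

/-- If `m`-measurable events `D a` cover the space and each event `{Z = a}` has conditional
probability at least `δ` given `m`, then the events `D a ∩ {Z = a}` have total probability at
least `δ`. -/
lemma le_sum_measureReal_inter_of_le_condExp {Ω ι : Type*} [Fintype ι] {m mΩ : MeasurableSpace Ω}
    (hm : m ≤ mΩ) {μ : Measure Ω} [IsProbabilityMeasure μ] {δ : ℝ} (hδ : 0 ≤ δ)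
    {E D : ι → Set Ω} (hE : ∀ a, MeasurableSet (E a)) (hD : ∀ a, MeasurableSet[m] (D a))
    (hcover : ∀ ω, ∃ a, ω ∈ D a)
    (hcond : ∀ a, ∀ᵐ ω ∂μ, δ ≤ (μ[(E a).indicator (fun _ => (1 : ℝ)) | m]) ω) :
    δ ≤ ∑ a, μ.real (D a ∩ E a) := by
  have hle (a : ι) : δ * μ.real (D a) ≤ μ.real (D a ∩ E a) := by
    have hint : Integrable ((E a).indicator (fun _ => (1 : ℝ))) μ :=
      (integrable_const 1).indicator (hE a)
    calc δ * μ.real (D a) = ∫ _ in D a, δ ∂μ := by simp [mul_comm]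
      _ ≤ ∫ ω in D a, (μ[(E a).indicator (fun _ => (1 : ℝ)) | m]) ω ∂μ :=
          integral_mono_ae (integrable_const _) integrable_condExp.integrableOn
            (ae_restrict_of_ae (hcond a))
      _ = ∫ ω in D a, (E a).indicator (fun _ => (1 : ℝ)) ω ∂μ :=
          setIntegral_condExp hm hint (hD a)
      _ = μ.real (D a ∩ E a) := by
          rw [setIntegral_indicator (hE a)]
          simp
  have hone : (1 : ℝ) ≤ ∑ a, μ.real (D a) := by
    have huniv : (⋃ a, D a) = Set.univ := Set.eq_univ_of_forall fun ω => Set.mem_iUnion.2 (hcover ω)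
    calc (1 : ℝ) = μ.real (⋃ a, D a) := by rw [huniv]; simp
      _ ≤ ∑ a, μ.real (D a) := measureReal_iUnion_fintype_le D
  calc δ ≤ δ * ∑ a, μ.real (D a) := le_mul_of_one_le_right hδ hone
    _ = ∑ a, δ * μ.real (D a) := Finset.mul_sum _ _ _
    _ ≤ _ := Finset.sum_le_sum fun a _ => hle a

/-- The one-step bound: conditionally on `m`, the two players play a magic square game whose
questions all have probability at least `δ`. -/
lemma integral_magicSquare_le {Ω : Type*} {m mΩ : MeasurableSpace Ω} (hm : m ≤ mΩ)
    {μ : Measure Ω} [IsProbabilityMeasure μ] {δ : ℝ} (hδ : 0 ≤ δ) {X Y : Ω → Fin 3}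
    (hX : Measurable X) (hY : Measurable Y)
    (hcond : ∀ i j, ∀ᵐ ω ∂μ,
      δ ≤ (μ[(fun ω' => if X ω' = i ∧ Y ω' = j then (1 : ℝ) else 0) | m]) ω)
    {U V : Ω → Fin 3 → ℤ}
    (hUmeas : ∀ k, Measurable[m ⊔ MeasurableSpace.comap X inferInstance] (fun ω => U ω k))
    (hVmeas : ∀ k, Measurable[m ⊔ MeasurableSpace.comap Y inferInstance] (fun ω => V ω k))
    (hUval : ∀ ω k, U ω k = 1 ∨ U ω k = -1) (hVval : ∀ ω k, V ω k = 1 ∨ V ω k = -1)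
    (hUprod : ∀ᵐ ω ∂μ, U ω 0 * U ω 1 * U ω 2 = 1)
    (hVprod : ∀ᵐ ω ∂μ, V ω 0 * V ω 1 * V ω 2 = -1) :
    ∫ ω, ((U ω (Y ω) * V ω (X ω) : ℤ) : ℝ) ∂μ ≤ 1 - 2 * δ := by
  classical
  obtain ⟨u, hum, hu, huU⟩ := exists_sign_triple_eq_on_fibers hUmeas hUval hUprod
  obtain ⟨v, hvm, hv, hvV⟩ := exists_sign_triple_eq_on_fibers hVmeas hVval hVprod
  let E : Fin 3 × Fin 3 → Set Ω := fun a => {ω | X ω = a.1 ∧ Y ω = a.2}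
  let D : Fin 3 × Fin 3 → Set Ω := fun a => {ω | u a.1 a.2 ω ≠ v a.2 a.1 ω}
  have hE (a) : MeasurableSet (E a) :=
    (hX (measurableSet_singleton a.1)).inter (hY (measurableSet_singleton a.2))
  have hD (a) : MeasurableSet[m] (D a) :=
    (@measurableSet_eq_fun _ _ m _ _ _ _ (hum a.1 a.2) (hvm a.2 a.1)).compl
  have hDE (a) : MeasurableSet (D a ∩ E a) := (hm _ (hD a)).inter (hE a)
  have hsum : δ ≤ ∑ a, μ.real (D a ∩ E a) := by
    refine le_sum_measureReal_inter_of_le_condExp hm hδ hE hD (fun ω => ?_) fun a => ?_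
    · obtain ⟨i, j, hij⟩ := exists_ne_of_row_prod_of_col_prod (u := fun i j => u i j ω)
        (v := fun j i => v j i ω) (fun i => hu i ω) (fun j => hv j ω)
      exact ⟨(i, j), hij⟩
    · have : (E a).indicator (fun _ => (1 : ℝ)) =
          fun ω' => if X ω' = a.1 ∧ Y ω' = a.2 then (1 : ℝ) else 0 := by
        ext ω'
        simp [E, Set.indicator_apply]
      rw [this]
      exact hcond a.1 a.2
  have hae : (fun ω => ((U ω (Y ω) * V ω (X ω) : ℤ) : ℝ)) =ᵐ[μ]
      fun ω => 1 - 2 * ∑ a, (D a ∩ E a).indicator (fun _ => (1 : ℝ)) ω := by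
    filter_upwards [huU, hvV] with ω h1 h2
    rw [Finset.sum_eq_single (X ω, Y ω)]
    · have hmem : ω ∈ D (X ω, Y ω) ∩ E (X ω, Y ω) ↔ U ω (Y ω) ≠ V ω (X ω) := by
        simp [D, E, h1, h2]
      simp only [Set.indicator_apply, hmem]
      rcases hUval ω (Y ω) with h3 | h3 <;> rcases hVval ω (X ω) with h4 | h4 <;>
        norm_num [h3, h4]
    · intro a _ ha
      refine Set.indicator_of_notMem (fun h => ha ?_) _
      exact Prod.ext h.2.1.symm h.2.2.symm
    · simp
  have hint (a) : Integrable ((D a ∩ E a).indicator (fun _ => (1 : ℝ))) μ :=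
    (integrable_const 1).indicator (hDE a)
  rw [integral_congr_ae hae, integral_sub (integrable_const 1)
    ((integrable_finsetSum _ fun a _ => hint a).const_mul 2), integral_const_mul,
    integral_finsetSum _ fun a _ => hint a]
  simp only [integral_indicator_const _ (hDE _), integral_const, probReal_univ, smul_eq_mul,
    mul_one]
  linarith

/-- The Cesàro means of a sequence in `[-1, 1]` that is bounded by `c` from index `1` on have
limit superior at most `c`. -/
lemma limsup_cesaro_le {a : ℕ → ℝ} {c : ℝ} (hlow : ∀ n, -1 ≤ a n) (ha0 : a 0 ≤ 1)
    (hac : ∀ n, 1 ≤ n → a n ≤ c) :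
    limsup (fun N : ℕ => (N : ℝ)⁻¹ * ∑ n ∈ Finset.range N, a n) atTop ≤ c := by
  have htend : Tendsto (fun N : ℕ => c + (N : ℝ)⁻¹ * (1 - c)) atTop (nhds c) := by
    simpa using (tendsto_inv_atTop_nhds_zero_nat (𝕜 := ℝ)).mul_const (1 - c) |>.const_add c
  have hlower : ∀ N : ℕ, -1 ≤ (N : ℝ)⁻¹ * ∑ n ∈ Finset.range N, a n := by
    intro N
    rcases N.eq_zero_or_pos with rfl | hN
    · simp
    · have hN' : (0 : ℝ) < N := by exact_mod_cast hN
      have := Finset.card_nsmul_le_sum (Finset.range N) a (-1) fun n _ => hlow n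
      rw [inv_mul_eq_div, le_div_iff₀ hN']
      simpa using this
  have hupper : ∀ᶠ N : ℕ in atTop,
      (N : ℝ)⁻¹ * ∑ n ∈ Finset.range N, a n ≤ c + (N : ℝ)⁻¹ * (1 - c) := by
    filter_upwards [eventually_ge_atTop 1] with N hN
    obtain ⟨M, rfl⟩ := Nat.exists_eq_add_of_le' hN
    have hpos : (0 : ℝ) < ((M + 1 : ℕ) : ℝ) := by positivity
    have hs : ∑ n ∈ Finset.range M, a (n + 1) ≤ M * c := by
      simpa using Finset.sum_le_card_nsmul (Finset.range M) (fun n => a (n + 1)) c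
        fun n _ => hac (n + 1) (by omega)
    rw [Finset.sum_range_succ', inv_mul_eq_div, inv_mul_eq_div, div_le_iff₀ hpos, add_mul,
      div_mul_cancel₀ _ hpos.ne']
    push_cast
    linarith
  calc _ ≤ limsup (fun N : ℕ => c + (N : ℝ)⁻¹ * (1 - c)) atTop :=
        limsup_le_limsup hupper
          (isCoboundedUnder_le_of_le atTop hlower) htend.isBoundedUnder_le
    _ = c := htend.limsup_eq

/-- Classical upper bound for the decentralized POMDP example.
`𝒢 n = σ(X₀,…,Xₙ₋₁, Y₀,…,Yₙ₋₁, W₀,…,Wₙ)` is the common-past σ-algebra,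
`𝒜 n = σ(X₀,…,Xₙ, W₀,…,Wₙ)` is Alice's information and
`ℬ n = σ(Y₀,…,Yₙ, W₀,…,Wₙ)` is Bob's information. If every one-step
conditional transition probability is at least `δ` (with `0 < δ < 1/9`),
Alice's actions `Uₙ` are `𝒜 n`-measurable sign triples with coordinate product
`+1` a.s., and Bob's actions `Vₙ` are `ℬ n`-measurable sign triples with
coordinate product `-1` a.s., then
`limsup_N (1/N) ∑_{n<N} E[Uₙ^{(Yₙ)} Vₙ^{(Xₙ)}] ≤ 1 - 2δ`. -/
theorem stmt_3 {Ω : Type*} [mΩ : MeasurableSpace Ω] (μ : Measure Ω) [IsProbabilityMeasure μ]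
    {𝒲 : Type*} [MeasurableSpace 𝒲]
    (δ : ℝ) (hδ0 : 0 < δ) (hδ1 : δ < 1 / 9)
    (X Y : ℕ → Ω → Fin 3) (W : ℕ → Ω → 𝒲)
    (hX : ∀ n, Measurable (X n)) (hY : ∀ n, Measurable (Y n))
    (hW : ∀ n, Measurable (W n))
    (𝒢 𝒜 ℬ : ℕ → MeasurableSpace Ω)
    (h𝒢 : ∀ n, 𝒢 n =
      (⨆ k ∈ Finset.range n, MeasurableSpace.comap (X k) inferInstance) ⊔
      (⨆ k ∈ Finset.range n, MeasurableSpace.comap (Y k) inferInstance) ⊔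
      (⨆ k ∈ Finset.range (n + 1), MeasurableSpace.comap (W k) inferInstance))
    (h𝒜 : ∀ n, 𝒜 n =
      (⨆ k ∈ Finset.range (n + 1), MeasurableSpace.comap (X k) inferInstance) ⊔
      (⨆ k ∈ Finset.range (n + 1), MeasurableSpace.comap (W k) inferInstance))
    (hℬ : ∀ n, ℬ n =
      (⨆ k ∈ Finset.range (n + 1), MeasurableSpace.comap (Y k) inferInstance) ⊔
      (⨆ k ∈ Finset.range (n + 1), MeasurableSpace.comap (W k) inferInstance))
    (hcond : ∀ n, 1 ≤ n → ∀ i j : Fin 3, ∀ᵐ ω ∂μ,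
      δ ≤ (μ[(fun ω' => if X n ω' = i ∧ Y n ω' = j then (1 : ℝ) else 0) | 𝒢 n]) ω)
    (U V : ℕ → Ω → Fin 3 → ℤ)
    (hUmeas : ∀ n (k : Fin 3), Measurable[𝒜 n] (fun ω => U n ω k))
    (hVmeas : ∀ n (k : Fin 3), Measurable[ℬ n] (fun ω => V n ω k))
    (hUval : ∀ n ω k, U n ω k = 1 ∨ U n ω k = -1)
    (hVval : ∀ n ω k, V n ω k = 1 ∨ V n ω k = -1)
    (hUprod : ∀ n, ∀ᵐ ω ∂μ, U n ω 0 * U n ω 1 * U n ω 2 = 1)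
    (hVprod : ∀ n, ∀ᵐ ω ∂μ, V n ω 0 * V n ω 1 * V n ω 2 = -1) :
    Filter.limsup
      (fun N : ℕ => (N : ℝ)⁻¹ *
        ∑ n ∈ Finset.range N, ∫ ω, ((U n ω (Y n ω) * V n ω (X n ω) : ℤ) : ℝ) ∂μ)
      Filter.atTop ≤ 1 - 2 * δ := by
  have hbound (n : ℕ) (ω : Ω) : |((U n ω (Y n ω) * V n ω (X n ω) : ℤ) : ℝ)| ≤ 1 := by
    rcases hUval n ω (Y n ω) with h1 | h1 <;> rcases hVval n ω (X n ω) with h2 | h2 <;>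
      simp [h1, h2]
  have habs (n : ℕ) : |∫ ω, ((U n ω (Y n ω) * V n ω (X n ω) : ℤ) : ℝ) ∂μ| ≤ 1 := by
    simpa using norm_integral_le_of_norm_le_const (μ := μ)
      (ae_of_all _ fun ω => (Real.norm_eq_abs _).trans_le (hbound n ω))
  refine limsup_cesaro_le (fun n => (abs_le.1 (habs n)).1) (abs_le.1 (habs 0)).2 fun n hn => ?_
  have hXle (n : ℕ) : (⨆ k ∈ Finset.range n, MeasurableSpace.comap (X k) inferInstance) ≤ mΩ :=
    iSup₂_le fun k _ => (hX k).comap_le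
  have hYle (n : ℕ) : (⨆ k ∈ Finset.range n, MeasurableSpace.comap (Y k) inferInstance) ≤ mΩ :=
    iSup₂_le fun k _ => (hY k).comap_le
  have hWle (n : ℕ) : (⨆ k ∈ Finset.range n, MeasurableSpace.comap (W k) inferInstance) ≤ mΩ :=
    iSup₂_le fun k _ => (hW k).comap_le
  have h𝒢m : 𝒢 n ≤ mΩ := by
    rw [h𝒢]
    exact sup_le (sup_le (hXle _) (hYle _)) (hWle _)
  have h𝒜𝒢 : 𝒜 n ≤ 𝒢 n ⊔ MeasurableSpace.comap (X n) inferInstance := by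
    rw [h𝒜, h𝒢, Finset.range_add_one (n := n), Finset.iSup_insert]
    refine sup_le (sup_le le_sup_right ?_) ?_
    · exact le_sup_of_le_left (le_sup_of_le_left le_sup_left)
    · rw [← Finset.range_add_one]
      exact le_sup_of_le_left le_sup_right
  have hℬ𝒢 : ℬ n ≤ 𝒢 n ⊔ MeasurableSpace.comap (Y n) inferInstance := by
    rw [hℬ, h𝒢, Finset.range_add_one (n := n), Finset.iSup_insert]
    refine sup_le (sup_le le_sup_right ?_) ?_
    · exact le_sup_of_le_left (le_sup_of_le_left le_sup_right)
    · rw [← Finset.range_add_one]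
      exact le_sup_of_le_left le_sup_right
  exact integral_magicSquare_le h𝒢m hδ0.le (hX n) (hY n) (hcond n hn)
    (fun k => (hUmeas n k).mono h𝒜𝒢 le_rfl) (fun k => (hVmeas n k).mono hℬ𝒢 le_rfl)
    (hUval n) (hVval n) (hUprod n) (hVprod n)
end

section
/- Let (Ω, ℱ, P) be a probability space, let (X,Y) be uniformly distributed on {1,2,3} × {1,2,3}, and let W be a random element of a measurable space 𝒲 independent of (X,Y). Let u : {1,2,3} × 𝒲 → ({1,−1})³ and v : {1,2,3} × 𝒲 → ({1,−1})³ be measurable functions such that u⁽¹⁾(x,w)·u⁽²⁾(x,w)·u⁽³⁾(x,w) = 1 for all (x,w) and v⁽¹⁾(y,w)·v⁽²⁾(y,w)·v⁽³⁾(y,w) = −1 for all (y,w). Then E[u^{(Y)}(X,W) · v^{(X)}(Y,W)] ≤ 7/9. -/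
open MeasureTheory ProbabilityTheory

/-- A finite family of signs whose product is `-1` contains a `-1`, so its sum is at most the
number of members minus two. -/
theorem sum_le_card_sub_two_of_prod_eq_neg_one {ι : Type*} [Fintype ι] (s : ι → ℤ)
    (hs : ∀ i, s i = 1 ∨ s i = -1) (hprod : ∏ i, s i = -1) :
    ∑ i, s i ≤ Fintype.card ι - 2 := by
  classical
  obtain ⟨i, hi⟩ : ∃ i, s i = -1 := by
    by_contra! h
    have : ∏ i, s i = 1 := Finset.prod_eq_one fun i _ => (hs i).resolve_right (h i)
    omega
  have hle : ∑ j, (s j - 1) ≤ s i - 1 := by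
    rw [← Finset.add_sum_erase _ _ (Finset.mem_univ i)]
    have : ∑ j ∈ Finset.univ.erase i, (s j - 1) ≤ 0 :=
      Finset.sum_nonpos fun j _ => by rcases hs j with h | h <;> omega
    omega
  simp only [Finset.sum_sub_distrib, Finset.sum_const, Finset.card_univ, nsmul_eq_mul,
    mul_one] at hle
  omega

/-- Deterministic strategies in the magic square game earn total reward at most `7` over the
nine question pairs. -/
theorem sum_magicSquare_le (a b : Fin 3 → Fin 3 → ℤ)
    (ha : ∀ x k, a x k = 1 ∨ a x k = -1) (hb : ∀ y k, b y k = 1 ∨ b y k = -1)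
    (haprod : ∀ x, a x 0 * a x 1 * a x 2 = 1) (hbprod : ∀ y, b y 0 * b y 1 * b y 2 = -1) :
    ∑ z : Fin 3 × Fin 3, a z.1 z.2 * b z.2 z.1 ≤ 7 := by
  refine (sum_le_card_sub_two_of_prod_eq_neg_one _ (fun z => ?_) ?_).trans (by simp)
  · rcases ha z.1 z.2 with h | h <;> rcases hb z.2 z.1 with h' | h' <;> simp [h, h']
  · rw [Finset.prod_mul_distrib, Fintype.prod_prod_type, Fintype.prod_prod_type_right]
    simp only [Fin.prod_univ_three, haprod, hbprod]
    norm_num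

/-- Averaging a function of an independent pair `(Z, W)`, with `Z` finitely valued, conditions
on the value of `Z`. -/
theorem ProbabilityTheory.IndepFun.integral_eq_sum {Ω 𝒲 ι : Type*} [MeasurableSpace Ω]
    [MeasurableSpace 𝒲] [Fintype ι] [MeasurableSpace ι] [MeasurableSingletonClass ι]
    {μ : Measure Ω} [IsProbabilityMeasure μ] {Z : Ω → ι} {W : Ω → 𝒲} (hindep : IndepFun Z W μ)
    (hZ : Measurable Z) (hW : Measurable W) {f : ι → 𝒲 → ℝ} (hf : ∀ z, Measurable (f z))
    {C : ℝ} (hC : ∀ z w, ‖f z w‖ ≤ C) :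
    ∫ ω, f (Z ω) (W ω) ∂μ = ∑ z, μ.real (Z ⁻¹' {z}) * ∫ ω, f z (W ω) ∂μ := by
  have := Measure.isProbabilityMeasure_map (μ := μ) hZ.aemeasurable
  have := Measure.isProbabilityMeasure_map (μ := μ) hW.aemeasurable
  have hmeas : Measurable fun p : ι × 𝒲 => f p.1 p.2 := measurable_from_prod_countable_right hf
  have hint : Integrable (fun p : ι × 𝒲 => f p.1 p.2) ((μ.map Z).prod (μ.map W)) :=
    .of_bound hmeas.aestronglyMeasurable C (.of_forall fun p => hC p.1 p.2)
  rw [← integral_map (f := fun p : ι × 𝒲 => f p.1 p.2) (hZ.prodMk hW).aemeasurable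
      hmeas.aestronglyMeasurable,
    (indepFun_iff_map_prod_eq_prod_map_map hZ.aemeasurable hW.aemeasurable).1 hindep,
    integral_prod _ hint, integral_fintype .of_finite]
  refine Finset.sum_congr rfl fun z _ => ?_
  rw [map_measureReal_apply hZ (measurableSet_singleton z), smul_eq_mul,
    integral_map hW.aemeasurable (hf z).aestronglyMeasurable]

/-- One-shot classical bound. If `(X, Y)` is uniform on
`{1,2,3}²`, `W` is common randomness independent of `(X, Y)`, and
`u, v : Fin 3 → 𝒲 → Fin 3 → ℤ` are measurable sign triples with coordinate
products `+1` resp. `-1`, then `E[u^{(Y)}(X, W) · v^{(X)}(Y, W)] ≤ 7/9`. -/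
theorem stmt_4 {Ω : Type*} [MeasurableSpace Ω] (μ : Measure Ω) [IsProbabilityMeasure μ]
    {𝒲 : Type*} [MeasurableSpace 𝒲]
    (X Y : Ω → Fin 3) (W : Ω → 𝒲)
    (hX : Measurable X) (hY : Measurable Y) (hW : Measurable W)
    (hunif : ∀ i j : Fin 3, μ {ω | X ω = i ∧ Y ω = j} = 1 / 9)
    (hindep : IndepFun (fun ω => (X ω, Y ω)) W μ)
    (u v : Fin 3 → 𝒲 → Fin 3 → ℤ)
    (humeas : ∀ (x : Fin 3) (k : Fin 3), Measurable (fun w => u x w k))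
    (hvmeas : ∀ (y : Fin 3) (k : Fin 3), Measurable (fun w => v y w k))
    (huval : ∀ x w k, u x w k = 1 ∨ u x w k = -1)
    (hvval : ∀ y w k, v y w k = 1 ∨ v y w k = -1)
    (huprod : ∀ x w, u x w 0 * u x w 1 * u x w 2 = 1)
    (hvprod : ∀ y w, v y w 0 * v y w 1 * v y w 2 = -1) :
    ∫ ω, ((u (X ω) (W ω) (Y ω) * v (Y ω) (W ω) (X ω) : ℤ) : ℝ) ∂μ ≤ 7 / 9 := by
  set f : Fin 3 × Fin 3 → 𝒲 → ℝ := fun z w => ((u z.1 w z.2 * v z.2 w z.1 : ℤ) : ℝ) with hf_def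
  have hf : ∀ z, Measurable (f z) := fun z =>
    measurable_from_top.comp ((humeas z.1 z.2).mul (hvmeas z.2 z.1))
  have hbound : ∀ z w, ‖f z w‖ ≤ 1 := fun z w => by
    rcases huval z.1 w z.2 with h | h <;> rcases hvval z.2 w z.1 with h' | h' <;>
      simp [hf_def, h, h']
  have hint : ∀ z, Integrable (fun ω => f z (W ω)) μ := fun z =>
    .of_bound ((hf z).comp hW).aestronglyMeasurable 1 (.of_forall fun ω => hbound z (W ω))
  have hZ : ∀ z, μ.real ((fun ω => (X ω, Y ω)) ⁻¹' {z}) = 1 / 9 := fun z => by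
    have hset : (fun ω => (X ω, Y ω)) ⁻¹' {z} = {ω | X ω = z.1 ∧ Y ω = z.2} := by
      ext ω
      simp [Prod.ext_iff]
    rw [hset, measureReal_def, hunif]
    simp
  have hsum : ∀ w, ∑ z, f z w ≤ 7 := fun w => by
    simp only [hf_def]
    exact_mod_cast sum_magicSquare_le (u · w) (v · w) (huval · w) (hvval · w)
      (huprod · w) (hvprod · w)
  calc ∫ ω, f (X ω, Y ω) (W ω) ∂μ
      = ∑ z, 1 / 9 * ∫ ω, f z (W ω) ∂μ := by
        rw [hindep.integral_eq_sum (hX.prodMk hY) hW hf hbound]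
        simp only [hZ]
    _ = 1 / 9 * ∫ ω, ∑ z, f z (W ω) ∂μ := by
        rw [← Finset.mul_sum, integral_finsetSum _ fun z _ => hint z]
    _ ≤ 1 / 9 * ∫ _, 7 ∂μ := by
        gcongr
        · exact integrable_finsetSum _ fun z _ => hint z
        · exact integrable_const _
        · exact fun ω => hsum (W ω)
    _ = 7 / 9 := by
        simp
        norm_num
end

section
/- (Classical bound for the Mermin–Peres game.) Let (Ω, ℱ, P) be a probability space, let (I,J) be uniformly distributed on {1,2,3} × {1,2,3}, and let W be a random element of a measurable space 𝒲 independent of (I,J). Let a : {1,2,3} × 𝒲 → ({1,−1})³ and b : {1,2,3} × 𝒲 → ({1,−1})³ be measurable functions such that a⁽¹⁾(i,w)·a⁽²⁾(i,w)·a⁽³⁾(i,w) = 1 for all (i,w) and b⁽¹⁾(j,w)·b⁽²⁾(j,w)·b⁽³⁾(j,w) = −1 for all (j,w). Then P(a^{(J)}(I,W) · b^{(I)}(J,W) = 1) ≤ 8/9. -/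
open MeasureTheory ProbabilityTheory

/-- If `X` takes each value of a finite type with probability `c`, independently of `W`, and the
sets `S x` cover the range of `W`, then `W ∈ S X` has probability at least `c`. -/
theorem le_measure_mem_of_indepFun_of_iUnion_eq_univ {Ω α β : Type*} [MeasurableSpace Ω]
    {μ : Measure Ω} [IsProbabilityMeasure μ] [Fintype α] [MeasurableSpace α]
    [MeasurableSingletonClass α] [MeasurableSpace β] {X : Ω → α} {W : Ω → β}
    (hX : Measurable X) (hW : Measurable W) (hindep : IndepFun X W μ) {c : ENNReal}
    (hc : ∀ x, μ (X ⁻¹' {x}) = c) {S : α → Set β} (hS : ∀ x, MeasurableSet (S x))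
    (hcover : ⋃ x, S x = Set.univ) :
    c ≤ μ {ω | W ω ∈ S (X ω)} := by
  have hone : 1 ≤ ∑ x, μ (W ⁻¹' S x) := by
    calc 1 = μ (⋃ x, W ⁻¹' S x) := by
          rw [← Set.preimage_iUnion, hcover, Set.preimage_univ, measure_univ]
      _ ≤ ∑ x, μ (W ⁻¹' S x) := measure_iUnion_fintype_le _ _
  have hdisj : Pairwise (Function.onFun Disjoint fun x => X ⁻¹' {x} ∩ W ⁻¹' S x) := by
    intro x y hxy
    refine Set.disjoint_left.2 ?_
    rintro ω ⟨hx, -⟩ ⟨hy, -⟩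
    exact hxy (hx.symm.trans hy)
  calc c ≤ c * ∑ x, μ (W ⁻¹' S x) := le_mul_of_one_le_right' hone
    _ = ∑ x, μ (X ⁻¹' {x} ∩ W ⁻¹' S x) := by
        rw [Finset.mul_sum]
        refine Finset.sum_congr rfl fun x _ => ?_
        rw [hindep.measure_inter_preimage_eq_mul _ _ (measurableSet_singleton x) (hS x), hc]
    _ = μ (⋃ x, X ⁻¹' {x} ∩ W ⁻¹' S x) := by
        rw [measure_iUnion hdisj fun x => (hX (measurableSet_singleton x)).inter (hW (hS x)),
          tsum_fintype]
    _ ≤ μ {ω | W ω ∈ S (X ω)} := by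
        refine measure_mono (Set.iUnion_subset ?_)
        rintro x ω ⟨rfl, hω⟩
        exact hω

/-- No pair of deterministic strategies wins the Mermin–Peres game on every pair of questions. -/
theorem exists_mul_ne_one_of_prod_eq {a b : Fin 3 → Fin 3 → ℤ}
    (ha : ∀ i, a i 0 * a i 1 * a i 2 = 1) (hb : ∀ j, b j 0 * b j 1 * b j 2 = -1) :
    ∃ i j, a i j * b j i ≠ 1 := by
  by_contra! h
  have hab : (∏ i, ∏ j, a i j) * ∏ j, ∏ i, b j i = 1 := by
    rw [Finset.prod_comm (f := fun j i => b j i)]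
    simp only [← Finset.prod_mul_distrib, h, Finset.prod_const_one]
  simp [Fin.prod_univ_three, ha, hb] at hab

/-- Classical bound for the Mermin–Peres game. If `(I, J)` is
uniform on `{1,2,3}²`, `W` is common randomness independent of `(I, J)`, Alice
outputs the sign triple `a(I, W)` with coordinate product `+1` and Bob outputs
the sign triple `b(J, W)` with coordinate product `-1`, then the winning
probability satisfies `P(a^{(J)}(I,W) · b^{(I)}(J,W) = 1) ≤ 8/9`. -/
theorem stmt_5 {Ω : Type*} [MeasurableSpace Ω] (μ : Measure Ω) [IsProbabilityMeasure μ]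
    {𝒲 : Type*} [MeasurableSpace 𝒲]
    (I J : Ω → Fin 3) (W : Ω → 𝒲)
    (hI : Measurable I) (hJ : Measurable J) (hW : Measurable W)
    (hunif : ∀ i j : Fin 3, μ {ω | I ω = i ∧ J ω = j} = 1 / 9)
    (hindep : IndepFun (fun ω => (I ω, J ω)) W μ)
    (a b : Fin 3 → 𝒲 → Fin 3 → ℤ)
    (hameas : ∀ (i : Fin 3) (k : Fin 3), Measurable (fun w => a i w k))
    (hbmeas : ∀ (j : Fin 3) (k : Fin 3), Measurable (fun w => b j w k))
    (haval : ∀ i w k, a i w k = 1 ∨ a i w k = -1)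
    (hbval : ∀ j w k, b j w k = 1 ∨ b j w k = -1)
    (haprod : ∀ i w, a i w 0 * a i w 1 * a i w 2 = 1)
    (hbprod : ∀ j w, b j w 0 * b j w 1 * b j w 2 = -1) :
    μ {ω | a (I ω) (W ω) (J ω) * b (J ω) (W ω) (I ω) = 1} ≤ 8 / 9 := by
  have hS : ∀ p : Fin 3 × Fin 3, MeasurableSet {w | a p.1 w p.2 * b p.2 w p.1 ≠ 1} := fun p =>
    ((hameas p.1 p.2).mul (hbmeas p.2 p.1)) (measurableSet_singleton (1 : ℤ)).compl
  have hcover : ⋃ p : Fin 3 × Fin 3, {w | a p.1 w p.2 * b p.2 w p.1 ≠ 1} = Set.univ := by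
    refine Set.eq_univ_of_forall fun w => Set.mem_iUnion.2 ?_
    obtain ⟨i, j, hij⟩ := exists_mul_ne_one_of_prod_eq (a := fun i => a i w) (b := fun j => b j w)
      (fun i => haprod i w) (fun j => hbprod j w)
    exact ⟨(i, j), hij⟩
  have hlose : 1 / 9 ≤ μ {ω | a (I ω) (W ω) (J ω) * b (J ω) (W ω) (I ω) ≠ 1} := by
    refine le_measure_mem_of_indepFun_of_iUnion_eq_univ (hI.prodMk hJ) hW hindep ?_ hS hcover
    rintro ⟨i, j⟩
    rw [← hunif i j]
    congr 1
    ext ω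
    simp
  have hmeas : MeasurableSet {ω | a (I ω) (W ω) (J ω) * b (J ω) (W ω) (I ω) ≠ 1} := by
    have hg : Measurable fun q : (Fin 3 × Fin 3) × 𝒲 =>
        a q.1.1 q.2 q.1.2 * b q.1.2 q.2 q.1.1 :=
      measurable_from_prod_countable_right fun p => (hameas p.1 p.2).mul (hbmeas p.2 p.1)
    exact (hg.comp ((hI.prodMk hJ).prodMk hW)) (measurableSet_singleton (1 : ℤ)).compl
  calc μ {ω | a (I ω) (W ω) (J ω) * b (J ω) (W ω) (I ω) = 1}
      = 1 - μ {ω | a (I ω) (W ω) (J ω) * b (J ω) (W ω) (I ω) ≠ 1} := by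
        rw [← prob_compl_eq_one_sub hmeas]
        congr 1
        ext ω
        simp
    _ ≤ 1 - 1 / 9 := tsub_le_tsub_left hlose 1
    _ = 8 / 9 := by
        have h : (1 : ENNReal) = 8 / 9 + 1 / 9 := by
          rw [← ENNReal.add_div]
          norm_num
          exact (ENNReal.div_self (by norm_num) (by norm_num)).symm
        exact ENNReal.sub_eq_of_eq_add (by simp) h
end

section
/- Let a : {1,2,3} → ({1,−1})³ and b : {1,2,3} → ({1,−1})³ be functions such that a⁽¹⁾(i)·a⁽²⁾(i)·a⁽³⁾(i) = 1 for every i and b⁽¹⁾(j)·b⁽²⁾(j)·b⁽³⁾(j) = −1 for every j. Then there exist i,j ∈ {1,2,3} with a⁽ʲ⁾(i)·b⁽ⁱ⁾(j) = −1; consequently the number of pairs (i,j) ∈ {1,2,3}² with a⁽ʲ⁾(i)·b⁽ⁱ⁾(j) = 1 is at most 8. -/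
/-- If `a : Fin 3 → Fin 3 → ℤ` gives Alice's deterministic sign
triples (coordinate product `+1`) and `b : Fin 3 → Fin 3 → ℤ` gives Bob's
deterministic sign triples (coordinate product `-1`), then some pair `(i, j)`
has `a⁽ʲ⁾(i) · b⁽ⁱ⁾(j) = -1`; consequently at most `8` of the `9` pairs satisfy
`a⁽ʲ⁾(i) · b⁽ⁱ⁾(j) = 1`. -/
theorem stmt_6 (a b : Fin 3 → Fin 3 → ℤ)
    (haval : ∀ i k, a i k = 1 ∨ a i k = -1)
    (hbval : ∀ j k, b j k = 1 ∨ b j k = -1)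
    (haprod : ∀ i, a i 0 * a i 1 * a i 2 = 1)
    (hbprod : ∀ j, b j 0 * b j 1 * b j 2 = -1) :
    (∃ i j : Fin 3, a i j * b j i = -1) ∧
      (Finset.univ.filter (fun p : Fin 3 × Fin 3 => a p.1 p.2 * b p.2 p.1 = 1)).card ≤ 8 := by
  have hex : ∃ i j : Fin 3, a i j * b j i = -1 := by
    by_contra! hne
    have hone : ∀ i j, a i j * b j i = 1 := fun i j => by
      have h := hne i j
      rcases haval i j with ha | ha <;> rcases hbval j i with hb | hb <;> simp_all
    have ha : ∏ i, ∏ j, a i j = 1 := by simp [Fin.prod_univ_three, haprod]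
    have hb : ∏ i, ∏ j, b j i = -1 := by
      rw [Finset.prod_comm]
      simp [Fin.prod_univ_three, hbprod]
    have hab : (∏ i, ∏ j, a i j) * ∏ i, ∏ j, b j i = 1 := by
      simp only [← Finset.prod_mul_distrib, hone, Finset.prod_const_one]
    rw [ha, hb] at hab
    norm_num at hab
  refine ⟨hex, ?_⟩
  obtain ⟨i, j, hij⟩ := hex
  refine Nat.le_of_lt_succ (Finset.card_lt_univ_of_notMem (x := (i, j)) ?_)
  simp [hij]
end

section
/- Within each row of the Mermin–Peres square, the three entries pairwise commute: for every i ∈ {1,2,3} and every l, l' ∈ {1,2,3}, the matrices M_{i,l} and M_{i,l'} satisfy M_{i,l}·M_{i,l'} = M_{i,l'}·M_{i,l}. -/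
open Matrix Kronecker

/-- The Pauli matrix `σ₀` (the 2×2 identity). -/
noncomputable def pauli0 : Matrix (Fin 2) (Fin 2) ℂ := 1

/-- The Pauli matrix `σ_x`. -/
noncomputable def pauliX : Matrix (Fin 2) (Fin 2) ℂ := !![0, 1; 1, 0]

/-- The Pauli matrix `σ_y`. -/
noncomputable def pauliY : Matrix (Fin 2) (Fin 2) ℂ := !![0, -Complex.I; Complex.I, 0]

/-- The Pauli matrix `σ_z`. -/
noncomputable def pauliZ : Matrix (Fin 2) (Fin 2) ℂ := !![1, 0; 0, -1]

/-- The Mermin–Peres square: a 3×3 array of 4×4 complex matrices (acting on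
`ℂ² ⊗ ℂ²`, whose index type `Fin 2 × Fin 2` is identified with `Fin 4`
lexicographically), built from the Pauli matrices via the Kronecker product. -/
noncomputable def MP : Fin 3 → Fin 3 → Matrix (Fin 2 × Fin 2) (Fin 2 × Fin 2) ℂ :=
  ![![pauli0 ⊗ₖ pauliZ, pauliZ ⊗ₖ pauli0, pauliZ ⊗ₖ pauliZ],
    ![pauliX ⊗ₖ pauli0, pauli0 ⊗ₖ pauliX, pauliX ⊗ₖ pauliX],
    ![-(pauliX ⊗ₖ pauliZ), -(pauliZ ⊗ₖ pauliX), pauliY ⊗ₖ pauliY]]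

theorem Matrix.commute_kronecker {R m n : Type*} [CommRing R] [Fintype m] [Fintype n]
    {A B : Matrix m m R} {C D : Matrix n n R} (hAB : Commute A B) (hCD : Commute C D) :
    Commute (A ⊗ₖ C) (B ⊗ₖ D) := by
  rw [Commute, SemiconjBy, ← mul_kronecker_mul, ← mul_kronecker_mul, hAB.eq, hCD.eq]

theorem Matrix.commute_kronecker_of_anticommute {R m n : Type*} [CommRing R] [Fintype m]
    [Fintype n] {A B : Matrix m m R} {C D : Matrix n n R} (hAB : A * B = -(B * A))
    (hCD : C * D = -(D * C)) : Commute (A ⊗ₖ C) (B ⊗ₖ D) := by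
  rw [Commute, SemiconjBy, ← mul_kronecker_mul, ← mul_kronecker_mul, hAB, hCD]
  ext
  simp [kroneckerMap_apply]

theorem pauliX_mul_pauliZ : pauliX * pauliZ = -(pauliZ * pauliX) := by
  simp [pauliX, pauliZ]

theorem pauliX_mul_pauliY : pauliX * pauliY = -(pauliY * pauliX) := by
  simp [pauliX, pauliY]

theorem pauliZ_mul_pauliY : pauliZ * pauliY = -(pauliY * pauliZ) := by
  simp [pauliZ, pauliY]

theorem pauli0_commute (A : Matrix (Fin 2) (Fin 2) ℂ) : Commute pauli0 A :=
  Commute.one_left A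

theorem commute_MP_row (i : Fin 3) :
    Commute (MP i 0) (MP i 1) ∧ Commute (MP i 0) (MP i 2) ∧ Commute (MP i 1) (MP i 2) := by
  fin_cases i
  · exact ⟨commute_kronecker (pauli0_commute _) (pauli0_commute _).symm,
      commute_kronecker (pauli0_commute _) (Commute.refl _),
      commute_kronecker (Commute.refl _) (pauli0_commute _)⟩
  · exact ⟨commute_kronecker (pauli0_commute _).symm (pauli0_commute _),
      commute_kronecker (Commute.refl _) (pauli0_commute _),
      commute_kronecker (pauli0_commute _) (Commute.refl _)⟩
  · have hZX : pauliZ * pauliX = -(pauliX * pauliZ) := by rw [pauliX_mul_pauliZ, neg_neg]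
    exact ⟨(commute_kronecker_of_anticommute pauliX_mul_pauliZ hZX).neg_left.neg_right,
      (commute_kronecker_of_anticommute pauliX_mul_pauliY pauliZ_mul_pauliY).neg_left,
      (commute_kronecker_of_anticommute pauliZ_mul_pauliY pauliX_mul_pauliY).neg_left⟩

/-- Within each row of the Mermin–Peres square, the three entries
pairwise commute. -/
theorem stmt_9 (i l l' : Fin 3) : MP i l * MP i l' = MP i l' * MP i l := by
  obtain ⟨h01, h02, h12⟩ := commute_MP_row i
  fin_cases l <;> fin_cases l' <;>
    first
    | rfl
    | exact h01
    | exact h02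
    | exact h12
    | exact h01.symm
    | exact h02.symm
    | exact h12.symm
end

section
/- For every row i ∈ {1,2,3} of the Mermin–Peres square, the product of the three entries of that row equals the 4×4 identity matrix: M_{i,1}·M_{i,2}·M_{i,3} = I₄. -/
open Matrix Kronecker

theorem pauliX_mul_self : pauliX * pauliX = 1 := by
  simp [pauliX, one_fin_two]

theorem pauliZ_mul_self : pauliZ * pauliZ = 1 := by
  simp [pauliZ, one_fin_two]

theorem pauliX_mul_pauliZ_mul_pauliY : pauliX * pauliZ * pauliY = (-Complex.I) • 1 := by
  simp [pauliX, pauliY, pauliZ, one_fin_two]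

theorem pauliZ_mul_pauliX_mul_pauliY : pauliZ * pauliX * pauliY = Complex.I • 1 := by
  simp [pauliX, pauliY, pauliZ, one_fin_two]

/-- The product of the three entries of each row of the
Mermin–Peres square equals the identity matrix. -/
theorem stmt_11 (i : Fin 3) : MP i 0 * MP i 1 * MP i 2 = 1 := by
  fin_cases i
  · simp [MP, pauli0, ← mul_kronecker_mul, pauliZ_mul_self]
  · simp [MP, pauli0, ← mul_kronecker_mul, pauliX_mul_self]
  · simp [MP, -neg_smul, ← mul_kronecker_mul, pauliX_mul_pauliZ_mul_pauliY,
      pauliZ_mul_pauliX_mul_pauliY, smul_kronecker, kronecker_smul, smul_smul]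
end

section
/- Let ψ ∈ ℂ⁴ ⊗ ℂ⁴ ≅ ℂ¹⁶ be the maximally entangled unit vector ψ = (1/2)·Σ_{k=0}^{3} e_k ⊗ e_k, where e₀,…,e₃ is the standard basis of ℂ⁴. Then for every entry M of the Mermin–Peres square, (M ⊗ M)·ψ = ψ; in particular ψᴴ·(M ⊗ M)·ψ = 1 for each of the nine entries M. -/
open Matrix Kronecker

/-- The maximally entangled unit vector `ψ = (1/2) ∑ₖ eₖ ⊗ eₖ` of
`ℂ⁴ ⊗ ℂ⁴ ≅ ℂ¹⁶`, where each `ℂ⁴` factor is indexed by `Fin 2 × Fin 2`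
(two qubits). -/
noncomputable def psi : (Fin 2 × Fin 2) × (Fin 2 × Fin 2) → ℂ :=
  fun p => if p.1 = p.2 then (1 / 2 : ℂ) else 0

theorem kronecker_mulVec_psi {M : Matrix (Fin 2 × Fin 2) (Fin 2 × Fin 2) ℂ}
    (hM : M * Mᵀ = 1) : (M ⊗ₖ M).mulVec psi = psi := by
  ext ⟨a, b⟩
  have h : ∑ x, M a x * M b x = if a = b then 1 else 0 := by
    simpa [mul_apply, one_apply] using congrFun₂ hM a b
  simp [mulVec, dotProduct, psi, Fintype.sum_prod_type (α₁ := Fin 2 × Fin 2), ← Finset.sum_mul,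
    h]

theorem star_psi_dotProduct_psi : star psi ⬝ᵥ psi = 1 := by
  simp [dotProduct, psi, Fintype.sum_prod_type (α₁ := Fin 2 × Fin 2), apply_ite]
  norm_num

theorem pauli0_mul_transpose : pauli0 * pauli0ᵀ = 1 := by
  simp [pauli0]

theorem pauliX_mul_transpose : pauliX * pauliXᵀ = 1 := by
  ext i j
  fin_cases i <;> fin_cases j <;> simp [pauliX, mul_apply]

theorem pauliY_mul_transpose : pauliY * pauliYᵀ = -1 := by
  ext i j
  fin_cases i <;> fin_cases j <;> simp [pauliY, mul_apply]

theorem pauliZ_mul_transpose : pauliZ * pauliZᵀ = 1 := by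
  ext i j
  fin_cases i <;> fin_cases j <;> simp [pauliZ, mul_apply]

theorem kronecker_mul_transpose (A B : Matrix (Fin 2) (Fin 2) ℂ) :
    (A ⊗ₖ B) * (A ⊗ₖ B)ᵀ = (A * Aᵀ) ⊗ₖ (B * Bᵀ) := by
  rw [mul_kronecker_mul, kroneckerMap_transpose]

theorem MP_mul_transpose (i l : Fin 3) : MP i l * (MP i l)ᵀ = 1 := by
  have neg_one_kronecker_neg_one :
      (-1 : Matrix (Fin 2) (Fin 2) ℂ) ⊗ₖ (-1 : Matrix (Fin 2) (Fin 2) ℂ) = 1 := by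
    ext ⟨a, b⟩ ⟨c, d⟩
    by_cases hac : a = c <;> by_cases hbd : b = d <;>
      simp [one_apply, hac, hbd, kroneckerMap_apply]
  fin_cases i <;> fin_cases l <;>
    simp [MP, kronecker_mul_transpose, pauli0_mul_transpose, pauliX_mul_transpose,
      pauliY_mul_transpose, pauliZ_mul_transpose, neg_one_kronecker_neg_one]

/-- For every entry `M` of the Mermin–Peres square,
`(M ⊗ M) ψ = ψ`; in particular `ψᴴ (M ⊗ M) ψ = 1`. -/
theorem stmt_14 (i l : Fin 3) :
    (MP i l ⊗ₖ MP i l).mulVec psi = psi ∧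
      star psi ⬝ᵥ (MP i l ⊗ₖ MP i l).mulVec psi = 1 := by
  have h := kronecker_mulVec_psi (MP_mul_transpose i l)
  exact ⟨h, by rw [h, star_psi_dotProduct_psi]⟩
end

section
/- (No dynamical quantum advantage in the cyclic example.) Let τ : {1,2,3}² → {1,2,3}² be the map defined by τ(1,1) = (1,2), τ(1,2) = (2,3), τ(2,3) = (2,2), τ(2,2) = (3,3), τ(3,3) = (3,1), τ(3,1) = (1,3), τ(1,3) = (2,1), τ(2,1) = (3,2), τ(3,2) = (1,1). For an initial state s ∈ {1,2,3}², write τⁿ(s) = (xₙ(s), yₙ(s)). Then there exist families of functions uₙ : {1,2,3}ⁿ⁺¹ → ({1,−1})³ with coordinate product +1 and vₙ : {1,2,3}ⁿ⁺¹ → ({1,−1})³ with coordinate product −1 (for n ≥ 0) such that for every initial state s ∈ {1,2,3}² and every n ≥ 2, the reward satisfies uₙ(x₀(s),…,xₙ(s))^{(yₙ(s))} · vₙ(y₀(s),…,yₙ(s))^{(xₙ(s))} = 1. In particular, for every initial state, lim_{N→∞} (1/N) Σ_{n=0}^{N−1} uₙ(x₀(s),…,xₙ(s))^{(yₙ(s))}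 · vₙ(y₀(s),…,yₙ(s))^{(xₙ(s))} = 1, the maximum possible value. -/
/- The cyclic transition map `τ` of the decentralized POMDP example of
Section 4, given by its nine defining equations. States `{1,2,3}²` are
modelled as `Fin 3 × Fin 3` (so state `(i,j)` corresponds to `(i-1, j-1)`):
τ(1,1)=(1,2), τ(1,2)=(2,3), τ(2,3)=(2,2), τ(2,2)=(3,3), τ(3,3)=(3,1),
τ(3,1)=(1,3), τ(1,3)=(2,1), τ(2,1)=(3,2), τ(3,2)=(1,1). -/

/-- Bob's estimate of Alice's current coordinate from his last three observations. -/
def decodeCoord : Fin 3 → Fin 3 → Fin 3 → Fin 3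
  | 0, 1, 2 => 1
  | 1, 2, 1 => 1
  | 0, 2, 0 => 1
  | 2, 1, 2 => 2
  | 1, 2, 0 => 2
  | 2, 0, 1 => 2
  | _, _, _ => 0

/-- A sign triple with product `-1` whose coordinate at `i` is `1`. -/
def oddSignTriple (i k : Fin 3) : ℤ := if k = i + 1 then -1 else 1

theorem oddSignTriple_eq_one_or (i k : Fin 3) :
    oddSignTriple i k = 1 ∨ oddSignTriple i k = -1 := by
  unfold oddSignTriple
  split_ifs <;> simp

theorem oddSignTriple_prod (i : Fin 3) :
    oddSignTriple i 0 * oddSignTriple i 1 * oddSignTriple i 2 = -1 := by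
  revert i
  decide

theorem oddSignTriple_self (i : Fin 3) : oddSignTriple i i = 1 := by
  revert i
  decide

/-- No dynamical quantum advantage in the cyclic example. There
exist (classical, deterministic) strategies: families of functions
`u n : (Fin (n+1) → Fin 3) → Fin 3 → ℤ` (Alice's action as a function of her
observations x₀,…,xₙ, a sign triple with coordinate product +1) and
`v n : (Fin (n+1) → Fin 3) → Fin 3 → ℤ` (Bob's action as a function of
y₀,…,yₙ, a sign triple with coordinate product -1) such that for every initial
state s and every n ≥ 2 the one-step reward uₙ^{(yₙ)} · vₙ^{(xₙ)} equals 1,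
and consequently for every initial state the long-term average reward tends
to 1, the maximum possible value. -/
theorem stmt_19 (τ : Fin 3 × Fin 3 → Fin 3 × Fin 3)
    (h11 : τ (0, 0) = (0, 1)) (h12 : τ (0, 1) = (1, 2)) (h23 : τ (1, 2) = (1, 1))
    (h22 : τ (1, 1) = (2, 2)) (h33 : τ (2, 2) = (2, 0)) (h31 : τ (2, 0) = (0, 2))
    (h13 : τ (0, 2) = (1, 0)) (h21 : τ (1, 0) = (2, 1)) (h32 : τ (2, 1) = (0, 0)) :
    ∃ (u : (n : ℕ) → (Fin (n + 1) → Fin 3) → Fin 3 → ℤ)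
      (v : (n : ℕ) → (Fin (n + 1) → Fin 3) → Fin 3 → ℤ),
      (∀ n xs k, u n xs k = 1 ∨ u n xs k = -1) ∧
      (∀ n ys k, v n ys k = 1 ∨ v n ys k = -1) ∧
      (∀ n xs, u n xs 0 * u n xs 1 * u n xs 2 = 1) ∧
      (∀ n ys, v n ys 0 * v n ys 1 * v n ys 2 = -1) ∧
      (∀ (s : Fin 3 × Fin 3) (n : ℕ), 2 ≤ n →
        u n (fun k : Fin (n + 1) => (τ^[(k : ℕ)] s).1) ((τ^[n] s).2) *
          v n (fun k : Fin (n + 1) => (τ^[(k : ℕ)] s).2) ((τ^[n] s).1) = 1) ∧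
      (∀ s : Fin 3 × Fin 3,
        Filter.Tendsto
          (fun N : ℕ => (N : ℝ)⁻¹ *
            ∑ n ∈ Finset.range N,
              ((u n (fun k : Fin (n + 1) => (τ^[(k : ℕ)] s).1) ((τ^[n] s).2) *
                v n (fun k : Fin (n + 1) => (τ^[(k : ℕ)] s).2) ((τ^[n] s).1) : ℤ) : ℝ))
          Filter.atTop (nhds 1)) := by
  have decode (t : Fin 3 × Fin 3) :
      decodeCoord t.2 (τ t).2 (τ (τ t)).2 = (τ (τ t)).1 := by
    obtain ⟨i, j⟩ := t
    fin_cases i <;> fin_cases j <;>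
      simp [h11, h12, h23, h22, h33, h31, h13, h21, h32, decodeCoord]
  let v (n : ℕ) (ys : Fin (n + 1) → Fin 3) : Fin 3 → ℤ :=
    oddSignTriple (decodeCoord (ys ⟨n - 2, by omega⟩) (ys ⟨n - 1, by omega⟩) (ys (Fin.last n)))
  have reward (s : Fin 3 × Fin 3) (n : ℕ) (hn : 2 ≤ n) :
      1 * v n (fun k : Fin (n + 1) => (τ^[(k : ℕ)] s).2) ((τ^[n] s).1) = 1 := by
    obtain ⟨m, rfl⟩ := Nat.exists_eq_add_of_le' hn
    have hm := decode (τ^[m] s)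
    simp only [← Function.iterate_succ_apply'] at hm
    simp only [v, Fin.val_last, one_mul, Nat.add_sub_cancel, Nat.add_succ_sub_one]
    rw [hm, oddSignTriple_self]
  refine ⟨fun _ _ _ => 1, v, by simp, fun _ _ _ => oddSignTriple_eq_one_or _ _, by simp,
    fun _ _ => oddSignTriple_prod _, reward, fun s => ?_⟩
  refine Filter.Tendsto.cesaro (tendsto_const_nhds.congr' ?_)
  filter_upwards [Filter.eventually_ge_atTop 2] with n hn
  rw [reward s n hn, Int.cast_one]
end
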